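/- There exists ε₀ > 0 such that for every ε ∈ (0,ε₀), every C > 0 and every δ > 0 there exists N with the following property: for all n ≥ N, any maximum choices of K2(G) for each G, and all integers t with 1 ≤ t ≤ s = ⌈C·log n⌉, |X3(n,t)| < (3/4)^{ε·n·t}·2^{δ·n·t}·4^{n·t}·F(n−2t). -/

import Mathlib

open Filter

noncomputable section

/-- A colored graph on `Fin n`: a simple graph whose edges are partitioned
into red and blue edges. -/
structure ColoredGraph (n : ℕ) where
  red : SimpleGraph (Fin n)
  blue : SimpleGraph (Fin n)
  disj : ∀ x y, ¬ (red.Adj x y ∧ blue.Adj x y)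

namespace ColoredGraph

variable {n : ℕ}

/-- The underlying (uncolored) simple graph. -/
def graph (G : ColoredGraph n) : SimpleGraph (Fin n) := G.red ⊔ G.blue

/-- Adjacency in a colored graph. -/
def Adj (G : ColoredGraph n) (x y : Fin n) : Prop := G.graph.Adj x y

/-- The neighborhood of a vertex. -/
def nbhd (G : ColoredGraph n) (x : Fin n) : Set (Fin n) := {y | G.Adj x y}

/-- `Γ(Q)`, the external neighborhood of a set of vertices. -/
def nbhdSet (G : ColoredGraph n) (Q : Set (Fin n)) : Set (Fin n) :=
  (⋃ x ∈ Q, G.nbhd x) \ Q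

/-- The degree of a vertex. -/
def deg (G : ColoredGraph n) (x : Fin n) : ℕ := (G.nbhd x).ncard

open scoped Classical in
/-- Indicator that the edge `xy` is blue. -/
def blueInd (G : ColoredGraph n) (x y : Fin n) : ℕ := if G.blue.Adj x y then 1 else 0

/-- Odd-blue-triangle-free: no triangle with an odd number of blue edges. -/
def OBTF (G : ColoredGraph n) : Prop :=
  ∀ x y z : Fin n, G.Adj x y → G.Adj y z → G.Adj x z →
    ¬ Odd (G.blueInd x y + G.blueInd y z + G.blueInd x z)

/-- The colored graph induced on the vertex set `A` is blue-bipartite: there is a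
partition `U ⊔ (A \ U)` of `A` such that blue edges within `A` cross the partition
and red edges within `A` do not. -/
def BlueBipartiteOn (G : ColoredGraph n) (A : Set (Fin n)) : Prop :=
  ∃ U ⊆ A, ∀ x ∈ A, ∀ y ∈ A,
    (G.blue.Adj x y → (x ∈ U ↔ y ∉ U)) ∧ (G.red.Adj x y → (x ∈ U ↔ y ∈ U))

/-- Blue-bipartite colored graph. -/
def BlueBipartite (G : ColoredGraph n) : Prop := G.BlueBipartiteOn Set.univ

/-- `κ(G)`: the minimum size of a vertex set whose removal leaves a blue-bipartite graph. -/
def kappa (G : ColoredGraph n) : ℕ :=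
  sInf {k | ∃ K : Set (Fin n), K.ncard = k ∧ G.BlueBipartiteOn Kᶜ}

end ColoredGraph

/-- `𝓕(n)`: the set of OBTF colored graphs on `[n]`. -/
def obtfSet (n : ℕ) : Set (ColoredGraph n) := {G | G.OBTF}

/-- `F(n) = |𝓕(n)|`. -/
def Fnum (n : ℕ) : ℕ := (obtfSet n).ncard

/-- `𝓑(n)`: the set of blue-bipartite colored graphs on `[n]`. -/
def bbSet (n : ℕ) : Set (ColoredGraph n) := {G | G.BlueBipartite}

/-- `|𝓑(n)|`. -/
def Bnum (n : ℕ) : ℕ := (bbSet n).ncard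

/-- `b(n) = 2^{n(n+1)/2 - 1}`. -/
def bnum (n : ℕ) : ℕ := 2 ^ (n * (n + 1) / 2 - 1)

/-- The binary entropy function (logarithms base 2). -/
def binH (x : ℝ) : ℝ := -x * Real.logb 2 x - (1 - x) * Real.logb 2 (1 - x)

/-- `K1(G)`: the set of vertices of degree less than `ε n`. -/
def K1 {n : ℕ} (G : ColoredGraph n) (ε : ℝ) : Set (Fin n) :=
  {x | (G.deg x : ℝ) < ε * n}

/-- `κ1(G) = |K1(G)|`. -/
def kappa1 {n : ℕ} (G : ColoredGraph n) (ε : ℝ) : ℕ := (K1 G ε).ncard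

/-- `X1(n,t)`: OBTF graphs with `κ1(G) ≥ t`. -/
def X1set (n t : ℕ) (ε : ℝ) : Set (ColoredGraph n) :=
  {G ∈ obtfSet n | t ≤ kappa1 G ε}

/-- `X0(n,t)`: OBTF graphs on `[n]` having a `t`-set of vertices `Q` with
`|Γ(Q)| < 0.6 n`. -/
def X0set (n t : ℕ) : Set (ColoredGraph n) :=
  {G ∈ obtfSet n | ∃ Q : Set (Fin n), Q.ncard = t ∧ ((G.nbhdSet Q).ncard : ℝ) < 0.6 * n}

/-- A collection witnessing `κ2(G) ≥ l`: `2l` distinct vertices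
`x_1,…,x_l,y_1,…,y_l ∈ [n] ∖ K1(G)` with `|Γ(x_i) ∩ Γ(y_i)| < ε n` for all `i`. -/
def IsK2Coll {n : ℕ} (G : ColoredGraph n) (ε : ℝ) (l : ℕ)
    (f : Fin l ⊕ Fin l → Fin n) : Prop :=
  Function.Injective f ∧ (∀ v, f v ∉ K1 G ε) ∧
    ∀ i : Fin l, ((G.nbhd (f (Sum.inl i)) ∩ G.nbhd (f (Sum.inr i))).ncard : ℝ) < ε * n

/-- `κ2(G)`: the largest `l` admitting a collection as above. -/
def kappa2 {n : ℕ} (G : ColoredGraph n) (ε : ℝ) : ℕ :=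
  sSup {l | ∃ f : Fin l ⊕ Fin l → Fin n, IsK2Coll G ε l f}

/-- `X2(n,t)`: graphs in `𝓕(n) ∖ (X0(n) ∪ X1(n))` with `κ2(G) ≥ t`,
where `X0(n) = X0(n,s)`, `X1(n) = X1(n,s)`, `s = ⌈C log₂ n⌉`. -/
def X2set (n t : ℕ) (ε C : ℝ) : Set (ColoredGraph n) :=
  {G ∈ obtfSet n \ (X0set n ⌈C * Real.logb 2 n⌉₊ ∪ X1set n ⌈C * Real.logb 2 n⌉₊ ε) |
    t ≤ kappa2 G ε}

/-- `K` is the vertex set of a maximum collection as in the definition of `κ2(G)`. -/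
def IsMaxK2 {n : ℕ} (G : ColoredGraph n) (ε : ℝ) (K : Set (Fin n)) : Prop :=
  ∃ f : Fin (kappa2 G ε) ⊕ Fin (kappa2 G ε) → Fin n,
    IsK2Coll G ε (kappa2 G ε) f ∧ Set.range f = K

/-- `I(x,Q_x)`: vertices `z` for which there are `x₁, x₂ ∈ Q_x` with
`x, x₁, z, x₂` a 4-cycle of `G` having an odd number of blue edges. -/
def Iset {n : ℕ} (G : ColoredGraph n) (x : Fin n) (Q : Set (Fin n)) : Set (Fin n) :=
  {z | ∃ x1 ∈ Q, ∃ x2 ∈ Q,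
    ([x, x1, z, x2] : List (Fin n)).Pairwise (· ≠ ·) ∧
    G.Adj x x1 ∧ G.Adj x1 z ∧ G.Adj z x2 ∧ G.Adj x2 x ∧
    Odd (G.blueInd x x1 + G.blueInd x1 z + G.blueInd z x2 + G.blueInd x2 x)}

/-- `I(x,Q_x,y,Q_y)`: vertices in `I(x,Q_x) ∪ I(y,Q_y)`, together with those `z`
for which there are `x₁ ∈ Q_x`, `y₁ ∈ Q_y` with `x, x₁, z, y₁, y` a 5-cycle of `G`
having an odd number of blue edges. -/
def Iset2 {n : ℕ} (G : ColoredGraph n) (x y : Fin n) (Qx Qy : Set (Fin n)) :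
    Set (Fin n) :=
  Iset G x Qx ∪ Iset G y Qy ∪
    {z | ∃ x1 ∈ Qx, ∃ y1 ∈ Qy,
      ([x, x1, z, y1, y] : List (Fin n)).Pairwise (· ≠ ·) ∧
      G.Adj x x1 ∧ G.Adj x1 z ∧ G.Adj z y1 ∧ G.Adj y1 y ∧ G.Adj y x ∧
      Odd (G.blueInd x x1 + G.blueInd x1 z + G.blueInd z y1 + G.blueInd y1 y +
        G.blueInd y x)}

/-- A collection witnessing `κ3(G) ≥ l` (relative to a choice `K2` of `K2(G)`):
`2l` distinct vertices `x_1,…,x_l,y_1,…,y_l ∈ [n] ∖ (K1(G) ∪ K2)` with `x_i ∼ y_i`,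
together with sets `Q_v ⊆ Γ(v)` avoiding the collection, of size `⌈log₂ n⌉`, whose
neighborhoods cover all but `2n^{1-ε}` of `[n] ∖ (K1(G) ∪ K2)`, and with
`|I(x_i, Q_{x_i}, y_i, Q_{y_i})| > ε n` for all `i`. -/
def IsK3Coll {n : ℕ} (G : ColoredGraph n) (ε : ℝ) (K2 : Set (Fin n)) (l : ℕ)
    (f : Fin l ⊕ Fin l → Fin n) (Q : Fin l ⊕ Fin l → Set (Fin n)) : Prop :=
  Function.Injective f ∧ (∀ v, f v ∉ K1 G ε ∪ K2) ∧
    (∀ i : Fin l, G.Adj (f (Sum.inl i)) (f (Sum.inr i))) ∧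
    (∀ v, Q v ⊆ G.nbhd (f v) \ Set.range f) ∧
    (∀ v, (Q v).ncard = ⌈Real.logb 2 n⌉₊) ∧
    (∀ v, ((Set.univ \ (K1 G ε ∪ K2 ∪ G.nbhdSet (Q v))).ncard : ℝ) <
      2 * (n : ℝ) ^ ((1 : ℝ) - ε)) ∧
    ∀ i : Fin l,
      ε * n <
        ((Iset2 G (f (Sum.inl i)) (f (Sum.inr i)) (Q (Sum.inl i)) (Q (Sum.inr i))).ncard : ℝ)

/-- `κ3(G)` (relative to a choice `K2` of `K2(G)`). -/
def kappa3 {n : ℕ} (G : ColoredGraph n) (ε : ℝ) (K2 : Set (Fin n)) : ℕ :=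
  sSup {l | ∃ f Q, IsK3Coll G ε K2 l f Q}

/-- `X3(n,t)`: graphs in `𝓕(n) ∖ (X0(n) ∪ X1(n) ∪ X2(n))` with `κ3(G) ≥ t`,
relative to a choice `K2c` of `K2(G)` for each `G`; here `s = ⌈C log₂ n⌉`. -/
def X3set (n t : ℕ) (ε C : ℝ) (K2c : ColoredGraph n → Set (Fin n)) :
    Set (ColoredGraph n) :=
  {G ∈ obtfSet n \
      (X0set n ⌈C * Real.logb 2 n⌉₊ ∪ X1set n ⌈C * Real.logb 2 n⌉₊ ε ∪
        X2set n ⌈C * Real.logb 2 n⌉₊ ε C) |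
    t ≤ kappa3 G ε (K2c G)}

/-! ### Colour encoding -/

open scoped Classical in
/-- The colour of a pair: `none` for a non-edge, `some true` for blue, `some false` for red. -/
def col {n : ℕ} (G : ColoredGraph n) (x y : Fin n) : Option Bool :=
  if G.Adj x y then some (decide (G.blue.Adj x y)) else none

theorem cg_adj_symm {n : ℕ} (G : ColoredGraph n) {x y : Fin n} (h : G.Adj x y) : G.Adj y x :=
  SimpleGraph.Adj.symm h

theorem col_symm {n : ℕ} (G : ColoredGraph n) (x y : Fin n) : col G x y = col G y x := by
  have h1 : G.Adj x y ↔ G.Adj y x := ⟨cg_adj_symm G, cg_adj_symm G⟩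
  have h2 : G.blue.Adj x y ↔ G.blue.Adj y x := G.blue.adj_comm x y
  unfold col
  by_cases a : G.Adj x y
  · have a' := h1.1 a
    rw [if_pos a, if_pos a']
    exact congrArg some (decide_eq_decide.2 h2)
  · have a' : ¬ G.Adj y x := fun h => a (h1.2 h)
    rw [if_neg a, if_neg a']

theorem col_of_adj {n : ℕ} (G : ColoredGraph n) {x y : Fin n} (h : G.Adj x y) :
    ∃ b : Bool, col G x y = some b ∧ G.blueInd x y = b.toNat := by
  classical
  refine ⟨decide (G.blue.Adj x y), by simp [col, h], ?_⟩
  by_cases hb : G.blue.Adj x y <;> simp [ColoredGraph.blueInd, hb]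

theorem adj_of_col {n : ℕ} (G : ColoredGraph n) {x y : Fin n} {b : Bool}
    (h : col G x y = some b) : G.Adj x y ∧ G.blueInd x y = b.toNat := by
  have ha : G.Adj x y := by
    by_contra hn
    simp [col, hn] at h
  obtain ⟨b', h1, h2⟩ := col_of_adj G ha
  rw [h] at h1
  cases h1
  exact ⟨ha, h2⟩

theorem col_tri {n : ℕ} (G : ColoredGraph n) (hG : G.OBTF) {x y z : Fin n} {a b c : Bool}
    (h1 : col G x y = some a) (h2 : col G y z = some b) (h3 : col G x z = some c) :
    c = xor a b := by
  obtain ⟨a1, a2⟩ := adj_of_col G h1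
  obtain ⟨b1, b2⟩ := adj_of_col G h2
  obtain ⟨c1, c2⟩ := adj_of_col G h3
  have := hG x y z a1 b1 c1
  rw [a2, b2, c2] at this
  revert this
  cases a <;> cases b <;> cases c <;> decide

theorem cg_ext {n : ℕ} {G H : ColoredGraph n} (h : ∀ x y, col G x y = col H x y) : G = H := by
  have hb : ∀ (G : ColoredGraph n) x y, G.blue.Adj x y ↔ col G x y = some true := by
    intro G x y
    constructor
    · intro hb
      have : G.Adj x y := Or.inr hb
      simp [col, this, hb]
    · intro hc
      have := (adj_of_col G hc).1
      simpa [col, this] using hc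
  have hr : ∀ (G : ColoredGraph n) x y, G.red.Adj x y ↔ col G x y = some false := by
    intro G x y
    constructor
    · intro hb
      have : G.Adj x y := Or.inl hb
      have h2 : ¬ G.blue.Adj x y := fun h => G.disj x y ⟨hb, h⟩
      simp [col, this, h2]
    · intro hc
      have h1 := (adj_of_col G hc).1
      have h2 : ¬ G.blue.Adj x y := by simpa [col, h1] using hc
      exact h1.resolve_right h2
  have e1 : G.red = H.red := by
    ext x y; rw [hr, hr, h]
  have e2 : G.blue = H.blue := by
    ext x y; rw [hb, hb, h]
  cases G; cases H
  simp only at e1 e2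
  subst e1 e2
  rfl

instance cg_finite (n : ℕ) : Finite (ColoredGraph n) :=
  Finite.of_injective (fun G : ColoredGraph n => fun x y => col G x y) (by
    intro G H h
    exact cg_ext fun x y => congrFun (congrFun h x) y)

/-- Pull-back of a colored graph along a map. -/
def cgComap {m n : ℕ} (G : ColoredGraph n) (g : Fin m → Fin n) : ColoredGraph m where
  red := G.red.comap g
  blue := G.blue.comap g
  disj := fun x y => G.disj (g x) (g y)

theorem col_comap {m n : ℕ} (G : ColoredGraph n) (g : Fin m → Fin n) (x y : Fin m) :
    col (cgComap G g) x y = col G (g x) (g y) := by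
  rfl

theorem obtf_comap {m n : ℕ} (G : ColoredGraph n) (g : Fin m → Fin n) (hG : G.OBTF) :
    (cgComap G g).OBTF := fun x y z => hG (g x) (g y) (g z)

theorem Iset_col {n : ℕ} (G : ColoredGraph n) {x : Fin n} {Q : Set (Fin n)} {z : Fin n}
    (h : z ∈ Iset G x Q) :
    ∃ x1 ∈ Q, ∃ x2 ∈ Q, ∃ a a1 b b1 : Bool, col G x x1 = some a ∧ col G x1 z = some a1 ∧
      col G x x2 = some b ∧ col G x2 z = some b1 ∧ xor a a1 ≠ xor b b1 := by
  obtain ⟨x1, h1, x2, h2, -, e1, e2, e3, e4, ho⟩ := h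
  obtain ⟨a, ha, ha'⟩ := col_of_adj G e1
  obtain ⟨a1, ha1, ha1'⟩ := col_of_adj G e2
  obtain ⟨b1, hb1, hb1'⟩ := col_of_adj G e3
  obtain ⟨b, hb, hb'⟩ := col_of_adj G e4
  refine ⟨x1, h1, x2, h2, a, a1, b, b1, ha, ha1, (col_symm G _ _).trans hb,
    (col_symm G _ _).trans hb1, ?_⟩
  rw [ha', ha1', hb1', hb'] at ho
  revert ho
  cases a <;> cases a1 <;> cases b <;> cases b1 <;> decide

theorem Iset2_col {n : ℕ} (G : ColoredGraph n) {x y : Fin n} {Qx Qy : Set (Fin n)} {z : Fin n}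
    (h : z ∈ Iset2 G x y Qx Qy) :
    z ∈ Iset G x Qx ∨ z ∈ Iset G y Qy ∨
    ∃ x1 ∈ Qx, ∃ y1 ∈ Qy, ∃ a a1 b b1 c : Bool, col G x x1 = some a ∧ col G x1 z = some a1 ∧
      col G y y1 = some b ∧ col G y1 z = some b1 ∧ col G x y = some c ∧
      xor b b1 ≠ xor c (xor a a1) := by
  rcases h with (h | h) | h
  · exact Or.inl h
  · exact Or.inr (Or.inl h)
  right; right
  obtain ⟨x1, h1, x2, h2, -, e1, e2, e3, e4, e5, ho⟩ := h
  obtain ⟨a, ha, ha'⟩ := col_of_adj G e1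
  obtain ⟨a1, ha1, ha1'⟩ := col_of_adj G e2
  obtain ⟨b1, hb1, hb1'⟩ := col_of_adj G e3
  obtain ⟨b, hb, hb'⟩ := col_of_adj G e4
  obtain ⟨c, hc, hc'⟩ := col_of_adj G e5
  refine ⟨x1, h1, x2, h2, a, a1, b, b1, c, ha, ha1, (col_symm G _ _).trans hb,
    (col_symm G _ _).trans hb1, (col_symm G _ _).trans hc, ?_⟩
  rw [ha', ha1', hb1', hb', hc'] at ho
  revert ho
  cases a <;> cases a1 <;> cases b <;> cases b1 <;> cases c <;> decide

/-! ### Local counting -/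

theorem card_le_four (S : Finset (Option Bool × Option Bool)) (a b : Bool)
    (h1 : ∀ p ∈ S, p.1 = none ∨ p.1 = some a) (h2 : ∀ p ∈ S, p.2 = none ∨ p.2 = some b) :
    S.card ≤ 4 := by
  have : S ⊆ ({none, some a} : Finset (Option Bool)) ×ˢ ({none, some b} : Finset (Option Bool)) := by
    intro p hp
    simp only [Finset.mem_product, Finset.mem_insert, Finset.mem_singleton]
    exact ⟨h1 p hp, h2 p hp⟩
  exact (Finset.card_le_card this).trans (by cases a <;> cases b <;> decide)

theorem card_le_three_left (S : Finset (Option Bool × Option Bool)) (b : Bool)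
    (h1 : ∀ p ∈ S, p.1 = none) (h2 : ∀ p ∈ S, p.2 = none ∨ p.2 = some b) :
    S.card ≤ 3 := by
  have : S ⊆ ({none} : Finset (Option Bool)) ×ˢ ({none, some b} : Finset (Option Bool)) := by
    intro p hp
    simp only [Finset.mem_product, Finset.mem_insert, Finset.mem_singleton]
    exact ⟨h1 p hp, h2 p hp⟩
  exact (Finset.card_le_card this).trans (by cases b <;> decide)

theorem card_le_three_right (S : Finset (Option Bool × Option Bool)) (a : Bool)
    (h1 : ∀ p ∈ S, p.1 = none ∨ p.1 = some a) (h2 : ∀ p ∈ S, p.2 = none) :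
    S.card ≤ 3 := by
  have : S ⊆ ({none, some a} : Finset (Option Bool)) ×ˢ ({none} : Finset (Option Bool)) := by
    intro p hp
    simp only [Finset.mem_product, Finset.mem_insert, Finset.mem_singleton]
    exact ⟨h1 p hp, h2 p hp⟩
  exact (Finset.card_le_card this).trans (by cases a <;> decide)

theorem card_le_three_both (S : Finset (Option Bool × Option Bool)) (a b : Bool)
    (h1 : ∀ p ∈ S, p.1 = none ∨ p.1 = some a) (h2 : ∀ p ∈ S, p.2 = none ∨ p.2 = some b)
    (h3 : ∀ p ∈ S, p.1 = none ∨ p.2 = none) :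
    S.card ≤ 3 := by
  have : S ⊆ ({(none, none), (some a, none), (none, some b)} :
      Finset (Option Bool × Option Bool)) := by
    rintro ⟨p, q⟩ hp
    have := h1 _ hp
    have := h2 _ hp
    have := h3 _ hp
    simp only [Finset.mem_insert, Finset.mem_singleton, Prod.mk.injEq]
    simp only at *
    tauto
  exact (Finset.card_le_card this).trans (by cases a <;> cases b <;> decide)

theorem prod_weight {n : ℕ} (T J : Finset (Fin n)) (w : Fin n → ℝ) (h0 : ∀ z, 0 ≤ w z)
    (h9 : ∀ z, w z ≤ 9) (h4 : ∀ z, z ∉ T → w z ≤ 4) (h3 : ∀ z ∈ J, z ∉ T → w z ≤ 3) :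
    ∏ z, w z ≤ 4 ^ n * (9 / 4) ^ T.card * (3 / 4) ^ (J \ T).card := by
  classical
  calc ∏ z, w z ≤ ∏ z : Fin n, ((4 : ℝ) * (if z ∈ T then 9 / 4 else 1) *
        (if z ∈ J \ T then 3 / 4 else 1)) := by
        apply Finset.prod_le_prod
        · intro z _; exact h0 z
        · intro z _
          by_cases hT : z ∈ T
          · have := h9 z
            simp [hT]; linarith
          · by_cases hJ : z ∈ J
            · have := h3 z hJ hT
              simp [hT, hJ]; linarith
            · have := h4 z hT
              simp [hT, hJ]; linarith
    _ = _ := by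
        rw [Finset.prod_mul_distrib, Finset.prod_mul_distrib]
        congr 1
        · congr 1
          · simp
          · rw [Finset.prod_ite_mem]; simp [div_pow]
        · rw [Finset.prod_ite_mem]; simp [div_pow]

theorem prod_weight' {n : ℕ} (T J : Finset (Fin n)) (w : Fin n → ℝ) (h0 : ∀ z, 0 ≤ w z)
    (h9 : ∀ z, w z ≤ 9) (h4 : ∀ z, z ∉ T → w z ≤ 4) (h3 : ∀ z ∈ J, z ∉ T → w z ≤ 3)
    (ε τ : ℝ) (hT : (T.card : ℝ) ≤ τ) (hJ : ε * n ≤ J.card) :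
    ∏ z, w z ≤ 4 ^ n * (3 / 4 : ℝ) ^ (ε * n) * 3 ^ τ := by
  refine (prod_weight T J w h0 h9 h4 h3).trans ?_
  have e1 : ((9 : ℝ) / 4) ^ T.card ≤ (9 / 4 : ℝ) ^ τ := by
    rw [← Real.rpow_natCast]
    exact Real.rpow_le_rpow_of_exponent_le (by norm_num) hT
  have hJT : ε * n - τ ≤ ((J \ T).card : ℝ) := by
    have : J.card ≤ (J \ T).card + T.card := Finset.card_le_card_sdiff_add_card
    have : (J.card : ℝ) ≤ (J \ T).card + T.card := by exact_mod_cast this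
    linarith
  have e2 : ((3 : ℝ) / 4) ^ (J \ T).card ≤ (3 / 4 : ℝ) ^ (ε * n - τ) := by
    rw [← Real.rpow_natCast]
    exact Real.rpow_le_rpow_of_exponent_ge (by norm_num) (by norm_num) hJT
  have e3 : (9 / 4 : ℝ) ^ τ * (3 / 4 : ℝ) ^ (ε * n - τ) = (3 / 4 : ℝ) ^ (ε * n) * 3 ^ τ := by
    rw [Real.rpow_sub (by norm_num)]
    have : (9 / 4 : ℝ) = 3 * (3 / 4) := by norm_num
    rw [this, Real.mul_rpow (by norm_num) (by norm_num)]
    have : (3 / 4 : ℝ) ^ τ ≠ 0 := (Real.rpow_pos_of_pos (by norm_num) _).ne'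
    field_simp
  calc _ ≤ 4 ^ n * (9 / 4 : ℝ) ^ τ * (3 / 4 : ℝ) ^ (ε * n - τ) := by gcongr
    _ = _ := by rw [mul_assoc, e3, mul_assoc]

/-- `G` agrees with `G0` outside `range f`, inside `range f`, and from `range f` to all `Q v`. -/
def SameData {n : ℕ} {V : Type} (f : V → Fin n) (Q : V → Set (Fin n))
    (G G0 : ColoredGraph n) : Prop :=
  (∀ u ∉ Set.range f, ∀ w ∉ Set.range f, col G u w = col G0 u w) ∧
  (∀ v v', col G (f v) (f v') = col G0 (f v) (f v')) ∧
  (∀ v v', ∀ w ∈ Q v', col G (f v) w = col G0 (f v) w)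

theorem same_forced {n : ℕ} {V : Type} {f : V → Fin n} {Q : V → Set (Fin n)}
    {G G0 : ColoredGraph n} (h : SameData f Q G G0) (hG : G.OBTF) {v : V} {x1 z : Fin n}
    (hQ : ∀ v, ∀ w ∈ Q v, w ∉ Set.range f)
    (hx1 : x1 ∈ Q v) (hz : z ∉ Set.range f) {a a1 : Bool} (ha : col G0 (f v) x1 = some a)
    (ha1 : col G0 x1 z = some a1) :
    col G (f v) z = none ∨ col G (f v) z = some (xor a a1) := by
  rw [← h.2.2 v v x1 hx1] at ha
  rw [← h.1 x1 (hQ v x1 hx1) z hz] at ha1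
  cases hc : col G (f v) z with
  | none => exact Or.inl rfl
  | some c =>
    right
    rw [col_tri G hG ha ha1 hc]

theorem same_Iset {n : ℕ} {V : Type} {f : V → Fin n} {Q : V → Set (Fin n)}
    {G G0 : ColoredGraph n} (h : SameData f Q G G0) (hG : G.OBTF) {v : V} {z : Fin n}
    (hQ : ∀ v, ∀ w ∈ Q v, w ∉ Set.range f)
    (hz : z ∉ Set.range f) (hI : z ∈ Iset G0 (f v) (Q v)) :
    col G (f v) z = none := by
  obtain ⟨x1, h1, x2, h2, a, a1, b, b1, e1, e2, e3, e4, hne⟩ := Iset_col G0 hI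
  rcases same_forced h hG hQ h1 hz e1 e2 with h' | h'
  · exact h'
  rcases same_forced h hG hQ h2 hz e3 e4 with h'' | h''
  · exact h''
  rw [h'] at h''
  have h3 := Option.some.inj h''
  exact absurd h3 hne

/-- Vertices whose pair of adjacencies is not controlled. -/
def badSet {n : ℕ} {V : Type} (f : V → Fin n) (Q : V → Set (Fin n)) (G0 : ColoredGraph n)
    (v v' : V) : Set (Fin n) :=
  Set.range f ∪ (G0.nbhdSet (Q v))ᶜ ∪ (G0.nbhdSet (Q v'))ᶜ

theorem nbhdSet_col {n : ℕ} {V : Type} {f : V → Fin n} {Q : V → Set (Fin n)}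
    {G0 : ColoredGraph n} {v : V} {z : Fin n} (hQ : Q v ⊆ G0.nbhd (f v))
    (h : z ∈ G0.nbhdSet (Q v)) :
    ∃ x1 ∈ Q v, ∃ a a1, col G0 (f v) x1 = some a ∧ col G0 x1 z = some a1 := by
  obtain ⟨h, -⟩ := h
  simp only [Set.mem_iUnion] at h
  obtain ⟨x1, hx1, hz⟩ := h
  obtain ⟨a, ha, -⟩ := col_of_adj G0 (hQ hx1)
  obtain ⟨a1, ha1, -⟩ := col_of_adj G0 hz
  exact ⟨x1, hx1, a, a1, ha, ha1⟩

open scoped Classical in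
/-- The fiber bound. -/
theorem fiber_bound {n t : ℕ} (ε τ : ℝ) (f : Fin t ⊕ Fin t → Fin n)
    (Q : Fin t ⊕ Fin t → Set (Fin n)) (G0 : ColoredGraph n)
    (hQ : ∀ v, Q v ⊆ G0.nbhd (f v) \ Set.range f)
    (hI : ∀ i : Fin t, ε * n <
        ((Iset2 G0 (f (Sum.inl i)) (f (Sum.inr i)) (Q (Sum.inl i)) (Q (Sum.inr i))).ncard : ℝ))
    (hT : ∀ i : Fin t, ((badSet f Q G0 (Sum.inl i) (Sum.inr i)).ncard : ℝ) ≤ τ)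
    (Φ : Finset (ColoredGraph n)) (hΦ : ∀ G ∈ Φ, G.OBTF ∧ SameData f Q G G0) :
    (Φ.card : ℝ) ≤ (4 ^ n * (3 / 4 : ℝ) ^ (ε * n) * 3 ^ τ) ^ t := by
  let pr : ColoredGraph n → Fin t → Fin n → Option Bool × Option Bool :=
    fun G i z => (col G (f (Sum.inl i)) z, col G (f (Sum.inr i)) z)
  let S : Fin t → Fin n → Finset (Option Bool × Option Bool) :=
    fun i z => Φ.image (fun G => pr G i z)
  have hQr : ∀ v, ∀ w ∈ Q v, w ∉ Set.range f := fun v w hw => (hQ v hw).2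
  have hQn : ∀ v, Q v ⊆ G0.nbhd (f v) := fun v w hw => (hQ v hw).1
  have hcard : Φ.card ≤ (Fintype.piFinset fun i => Fintype.piFinset fun z => S i z).card := by
    apply Finset.card_le_card_of_injOn pr
    · intro G hG
      simp only [Finset.mem_coe, Fintype.mem_piFinset]
      intro i z
      exact Finset.mem_image_of_mem _ hG
    · intro G hG H hH he
      have hv : ∀ v z, col G (f v) z = col H (f v) z := by
        intro v z
        rcases v with i | i
        · exact congrArg Prod.fst (congrFun (congrFun he i) z)
        · exact congrArg Prod.snd (congrFun (congrFun he i) z)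
      apply cg_ext
      intro x y
      by_cases hx : x ∈ Set.range f
      · obtain ⟨v, rfl⟩ := hx
        exact hv v y
      · by_cases hy : y ∈ Set.range f
        · obtain ⟨v, rfl⟩ := hy
          rw [col_symm G, col_symm H]
          exact hv v x
        · rw [(hΦ G hG).2.1 x hx y hy, (hΦ H hH).2.1 x hx y hy]
  have hcard' : (Φ.card : ℝ) ≤ ∏ i, ∏ z, ((S i z).card : ℝ) := by
    have : Φ.card ≤ ∏ i, ∏ z, (S i z).card := by
      simpa only [Fintype.card_piFinset] using hcard
    exact_mod_cast this
  refine hcard'.trans ?_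
  have hone : ∀ i : Fin t, ∏ z, ((S i z).card : ℝ) ≤ 4 ^ n * (3 / 4 : ℝ) ^ (ε * n) * 3 ^ τ := by
    intro i
    apply prod_weight' (badSet f Q G0 (Sum.inl i) (Sum.inr i)).toFinset
      (Iset2 G0 (f (Sum.inl i)) (f (Sum.inr i)) (Q (Sum.inl i)) (Q (Sum.inr i))).toFinset
    · intro z; positivity
    · intro z
      have : (S i z).card ≤ 9 := (Finset.card_le_univ _).trans (by simp)
      exact_mod_cast this
    · intro z hz
      rw [Set.mem_toFinset] at hz
      simp only [badSet, Set.mem_union, not_or, Set.mem_compl_iff, not_not] at hz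
      obtain ⟨⟨hz1, hz2⟩, hz3⟩ := hz
      obtain ⟨x1, hx1, a, a1, ha, ha1⟩ := nbhdSet_col (hQn _) hz2
      obtain ⟨y1, hy1, b, b1, hb, hb1⟩ := nbhdSet_col (hQn _) hz3
      have : (S i z).card ≤ 4 := by
        apply card_le_four _ (xor a a1) (xor b b1)
        · intro p hp
          obtain ⟨G, hG, rfl⟩ := Finset.mem_image.1 hp
          exact same_forced (hΦ G hG).2 (hΦ G hG).1 hQr hx1 hz1 ha ha1
        · intro p hp
          obtain ⟨G, hG, rfl⟩ := Finset.mem_image.1 hp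
          exact same_forced (hΦ G hG).2 (hΦ G hG).1 hQr hy1 hz1 hb hb1
      exact_mod_cast this
    · intro z hzI hz
      rw [Set.mem_toFinset] at hz
      simp only [badSet, Set.mem_union, not_or, Set.mem_compl_iff, not_not] at hz
      rw [Set.mem_toFinset] at hzI
      obtain ⟨⟨hz1, hz2⟩, hz3⟩ := hz
      have : (S i z).card ≤ 3 := by
        rcases Iset2_col G0 hzI with h | h | h
        · obtain ⟨y1, hy1, b, b1, hb, hb1⟩ := nbhdSet_col (hQn _) hz3
          apply card_le_three_left _ (xor b b1)
          · intro p hp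
            obtain ⟨G, hG, rfl⟩ := Finset.mem_image.1 hp
            exact same_Iset (hΦ G hG).2 (hΦ G hG).1 hQr hz1 h
          · intro p hp
            obtain ⟨G, hG, rfl⟩ := Finset.mem_image.1 hp
            exact same_forced (hΦ G hG).2 (hΦ G hG).1 hQr hy1 hz1 hb hb1
        · obtain ⟨x1, hx1, a, a1, ha, ha1⟩ := nbhdSet_col (hQn _) hz2
          apply card_le_three_right _ (xor a a1)
          · intro p hp
            obtain ⟨G, hG, rfl⟩ := Finset.mem_image.1 hp
            exact same_forced (hΦ G hG).2 (hΦ G hG).1 hQr hx1 hz1 ha ha1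
          · intro p hp
            obtain ⟨G, hG, rfl⟩ := Finset.mem_image.1 hp
            exact same_Iset (hΦ G hG).2 (hΦ G hG).1 hQr hz1 h
        · obtain ⟨x1, hx1, y1, hy1, a, a1, b, b1, c, ha, ha1, hb, hb1, hc, hne⟩ := h
          have k1 : ∀ p ∈ S i z, p.1 = none ∨ p.1 = some (xor a a1) := by
            intro p hp
            obtain ⟨G, hG, rfl⟩ := Finset.mem_image.1 hp
            exact same_forced (hΦ G hG).2 (hΦ G hG).1 hQr hx1 hz1 ha ha1
          have k2 : ∀ p ∈ S i z, p.2 = none ∨ p.2 = some (xor b b1) := by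
            intro p hp
            obtain ⟨G, hG, rfl⟩ := Finset.mem_image.1 hp
            exact same_forced (hΦ G hG).2 (hΦ G hG).1 hQr hy1 hz1 hb hb1
          apply card_le_three_both _ (xor a a1) (xor b b1) k1 k2
          intro p hp
          rcases k1 p hp with h1 | h1
          · exact Or.inl h1
          rcases k2 p hp with h2 | h2
          · exact Or.inr h2
          exfalso
          obtain ⟨G, hG, rfl⟩ := Finset.mem_image.1 hp
          have hc' : col G (f (Sum.inr i)) (f (Sum.inl i)) = some c := by
            rw [col_symm, (hΦ G hG).2.2.1, hc]
          exact hne (col_tri G (hΦ G hG).1 hc' h1 h2)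
      exact_mod_cast this
    · rw [← Set.ncard_eq_toFinset_card']
      exact hT i
    · rw [← Set.ncard_eq_toFinset_card']
      exact (hI i).le
  calc ∏ i, ∏ z, ((S i z).card : ℝ) ≤ ∏ _i : Fin t, (4 ^ n * (3 / 4 : ℝ) ^ (ε * n) * 3 ^ τ) :=
        Finset.prod_le_prod (fun i _ => by positivity) (fun i _ => hone i)
    _ = _ := by simp

/-! ### Assembling the bound -/

theorem exists_enum {n k : ℕ} (S : Set (Fin n)) (h : S.ncard = k) :
    ∃ g : Fin k → Fin n, Set.range g = S := by
  classical
  rw [Set.ncard_eq_toFinset_card'] at h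
  exact ⟨S.toFinset.orderEmbOfFin h, by simp⟩

theorem K3_restrict {n t : ℕ} (G : ColoredGraph n) (ε : ℝ) (K : Set (Fin n)) (ht : 1 ≤ t)
    (h : t ≤ kappa3 G ε K) : ∃ f Q, IsK3Coll G ε K t f Q := by
  have hne : {l | ∃ f Q, IsK3Coll G ε K l f Q}.Nonempty := by
    by_contra hcon
    rw [Set.not_nonempty_iff_eq_empty] at hcon
    unfold kappa3 at h
    rw [hcon] at h
    simp at h
    omega
  have hbdd : BddAbove {l | ∃ f Q, IsK3Coll G ε K l f Q} := by
    refine ⟨n, ?_⟩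
    rintro l ⟨f, Q, hf, -⟩
    have := Fintype.card_le_of_injective f hf
    simp at this
    omega
  obtain ⟨f, Q, h1, h2, h3, h4, h5, h6, h7⟩ := Nat.sSup_mem hne hbdd
  let e : Fin t ⊕ Fin t → Fin (kappa3 G ε K) ⊕ Fin (kappa3 G ε K) :=
    Sum.map (Fin.castLE h) (Fin.castLE h)
  have he : Function.Injective e :=
    Function.Injective.sumMap (Fin.castLE_injective h) (Fin.castLE_injective h)
  refine ⟨f ∘ e, Q ∘ e, h1.comp he, fun v => h2 _, fun i => h3 _, fun v w hw => ?_, fun v => h5 _,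
    fun v => h6 _, fun i => h7 _⟩
  refine ⟨(h4 _ hw).1, fun hr => (h4 _ hw).2 ?_⟩
  obtain ⟨u, rfl⟩ := hr
  exact ⟨e u, rfl⟩

theorem ncard_range_le {n t : ℕ} (f : Fin t ⊕ Fin t → Fin n) : (Set.range f).ncard ≤ 2 * t := by
  have : (f '' Set.univ).ncard ≤ (Set.univ : Set (Fin t ⊕ Fin t)).ncard := Set.ncard_image_le
  rw [Set.image_univ, Set.ncard_univ] at this
  simp at this
  omega

theorem bad_card {n t s : ℕ} {G : ColoredGraph n} {ε : ℝ} {K : Set (Fin n)}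
    {f : Fin t ⊕ Fin t → Fin n} {Q : Fin t ⊕ Fin t → Set (Fin n)} (h : IsK3Coll G ε K t f Q)
    (h1 : (K1 G ε).ncard ≤ s) (h2 : K.ncard ≤ 2 * s) (v v' : Fin t ⊕ Fin t) :
    ((badSet f Q G v v').ncard : ℝ) ≤ 2 * t + 6 * s + 4 * (n : ℝ) ^ ((1 : ℝ) - ε) := by
  have key : ∀ v, (((G.nbhdSet (Q v))ᶜ).ncard : ℝ) ≤ 3 * s + 2 * (n : ℝ) ^ ((1 : ℝ) - ε) := by
    intro v
    have hsub : (G.nbhdSet (Q v))ᶜ ⊆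
        (K1 G ε ∪ K) ∪ (Set.univ \ (K1 G ε ∪ K ∪ G.nbhdSet (Q v))) := by
      intro z hz
      by_cases hk : z ∈ K1 G ε ∪ K
      · exact Or.inl hk
      · right
        refine ⟨trivial, ?_⟩
        rintro (h | h)
        · exact hk h
        · exact hz h
    have a1 := Set.ncard_le_ncard hsub (Set.toFinite _)
    have a2 := Set.ncard_union_le (K1 G ε ∪ K) (Set.univ \ (K1 G ε ∪ K ∪ G.nbhdSet (Q v)))
    have a3 := Set.ncard_union_le (K1 G ε) K
    have a4 := h.2.2.2.2.2.1 v
    have a5 : ((G.nbhdSet (Q v))ᶜ).ncard ≤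
      3 * s + (Set.univ \ (K1 G ε ∪ K ∪ G.nbhdSet (Q v))).ncard := by omega
    have a6 : (((G.nbhdSet (Q v))ᶜ).ncard : ℝ) ≤
      3 * s + (Set.univ \ (K1 G ε ∪ K ∪ G.nbhdSet (Q v))).ncard := by exact_mod_cast a5
    linarith
  have b1 : (badSet f Q G v v').ncard ≤
      2 * t + ((G.nbhdSet (Q v))ᶜ).ncard + ((G.nbhdSet (Q v'))ᶜ).ncard := by
    have c1 := Set.ncard_union_le (Set.range f ∪ (G.nbhdSet (Q v))ᶜ) (G.nbhdSet (Q v'))ᶜ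
    have c2 := Set.ncard_union_le (Set.range f) (G.nbhdSet (Q v))ᶜ
    have c3 := ncard_range_le f
    unfold badSet
    omega
  have b2 : ((badSet f Q G v v').ncard : ℝ) ≤
      2 * t + ((G.nbhdSet (Q v))ᶜ).ncard + ((G.nbhdSet (Q v'))ᶜ).ncard := by exact_mod_cast b1
  have := key v
  have := key v'
  linarith

theorem Fnum_pos (m : ℕ) : 0 < Fnum m := by
  unfold Fnum
  rw [Set.ncard_pos (Set.toFinite _)]
  refine ⟨⟨⊥, ⊥, by simp⟩, ?_⟩
  intro x y z h
  simp [ColoredGraph.Adj, ColoredGraph.graph] at h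

/-- The combinatorial counting bound. -/
theorem X3_count_raw {n t : ℕ} (ε C : ℝ) (K2c : ColoredGraph n → Set (Fin n))
    (hK2 : ∀ G, IsMaxK2 G ε (K2c G)) (ht : 1 ≤ t) :
    ((X3set n t ε C K2c).ncard : ℝ) ≤
      (4 ^ n * (3 / 4 : ℝ) ^ (ε * n) *
        3 ^ (2 * (t : ℝ) + 6 * (⌈C * Real.logb 2 n⌉₊ : ℝ) + 4 * (n : ℝ) ^ ((1 : ℝ) - ε))) ^ t *
      ((n : ℝ) ^ (2 * t) * (n : ℝ) ^ (⌈Real.logb 2 n⌉₊ * (2 * t)) * 3 ^ (2 * t * (2 * t)) *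
        3 ^ (⌈Real.logb 2 n⌉₊ * (2 * t) * (2 * t)) * Fnum (n - 2 * t)) := by
  classical
  set s := ⌈C * Real.logb 2 n⌉₊ with hs
  set L := ⌈Real.logb 2 n⌉₊ with hL
  set τ : ℝ := 2 * (t : ℝ) + 6 * (s : ℝ) + 4 * (n : ℝ) ^ ((1 : ℝ) - ε) with hτ
  have hex : ∀ G : X3set n t ε C K2c, ∃ (f : Fin t ⊕ Fin t → Fin n)
      (q : Fin t ⊕ Fin t → Fin L → Fin n),
      IsK3Coll G.1 ε (K2c G.1) t f (fun v => Set.range (q v)) := by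
    intro G
    obtain ⟨f, Q, h⟩ := K3_restrict G.1 ε (K2c G.1) ht G.2.2
    choose q hq using fun v => exists_enum (Q v) (h.2.2.2.2.1 v)
    refine ⟨f, q, ?_⟩
    have : (fun v => Set.range (q v)) = Q := funext hq
    rw [this]
    exact h
  choose f q hfq using hex
  have hgex : ∀ f : Fin t ⊕ Fin t → Fin n, ∃ g : Fin (n - 2 * t) → Fin n,
      Function.Injective f → Set.range g = (Set.range f)ᶜ := by
    intro f
    by_cases hf : Function.Injective f
    · have h1 : (Set.range f)ᶜ.ncard = n - 2 * t := by
        have := Set.ncard_add_ncard_compl (Set.range f)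
        have h2 : (Set.range f).ncard = 2 * t := by
          rw [← Set.image_univ, Set.ncard_image_of_injective _ hf, Set.ncard_univ]
          simp
          omega
        simp at this
        omega
      obtain ⟨g, hg⟩ := exists_enum _ h1
      exact ⟨g, fun _ => hg⟩
    · exact ⟨Fin.castLE (Nat.sub_le _ _), fun h => absurd h hf⟩
  choose g hg using hgex
  have hobtf : ∀ G : X3set n t ε C K2c, G.1.OBTF := fun G => G.2.1.1
  let D : X3set n t ε C K2c → (Fin t ⊕ Fin t → Fin n) × (Fin t ⊕ Fin t → Fin L → Fin n) ×
      (Fin t ⊕ Fin t → Fin t ⊕ Fin t → Option Bool) ×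
      (Fin t ⊕ Fin t → Fin t ⊕ Fin t → Fin L → Option Bool) × (obtfSet (n - 2 * t)) :=
    fun G => (f G, q G, fun v v' => col G.1 (f G v) (f G v'),
      fun v v' j => col G.1 (f G v) (q G v' j),
      ⟨cgComap G.1 (g (f G)), obtf_comap _ _ (hobtf G)⟩)
  have : Fintype (ColoredGraph n) := Fintype.ofFinite _
  have : Fintype (ColoredGraph (n - 2 * t)) := Fintype.ofFinite _
  set M : ℝ := (4 ^ n * (3 / 4 : ℝ) ^ (ε * n) * 3 ^ τ) ^ t with hM
  have hM0 : 0 ≤ M := by positivity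
  have hfib : ∀ d, (Finset.univ.filter (fun G => D G = d)).card ≤ ⌊M⌋₊ := by
    intro d
    apply Nat.le_floor
    by_cases hemp : (Finset.univ.filter (fun G => D G = d)) = ∅
    · rw [hemp]; simpa using hM0
    obtain ⟨G0, hG0⟩ := Finset.nonempty_iff_ne_empty.2 hemp
    have hD0 : D G0 = d := (Finset.mem_filter.1 hG0).2
    have hco := hfq G0
    rw [← Finset.card_image_of_injective _ Subtype.val_injective]
    apply fiber_bound ε τ (f G0) (fun v => Set.range (q G0 v)) G0.1 hco.2.2.2.1
      hco.2.2.2.2.2.2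
    · intro i
      apply bad_card hco
      · have : G0.1 ∉ X1set n s ε := fun h => G0.2.1.2 (Or.inl (Or.inr h))
        have h2 : ¬ (s ≤ kappa1 G0.1 ε) := fun h => this ⟨G0.2.1.1, h⟩
        unfold kappa1 at h2
        omega
      · have : G0.1 ∉ X2set n s ε C := fun h => G0.2.1.2 (Or.inr h)
        have h2 : ¬ (s ≤ kappa2 G0.1 ε) := fun h =>
          this ⟨⟨G0.2.1.1, fun h' => G0.2.1.2 (Or.inl h')⟩, h⟩
        obtain ⟨k, -, hk⟩ := hK2 G0.1
        have := ncard_range_le k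
        rw [hk] at this
        omega
    · intro G' hG'
      obtain ⟨G, hG, rfl⟩ := Finset.mem_image.1 hG'
      have hD : D G = D G0 := ((Finset.mem_filter.1 hG).2).trans hD0.symm
      have e1 : f G = f G0 := congrArg Prod.fst hD
      have e2 : q G = q G0 := congrArg (fun p => p.2.1) hD
      have e3 : (fun v v' => col G.1 (f G v) (f G v')) =
        fun v v' => col G0.1 (f G0 v) (f G0 v') := congrArg (fun p => p.2.2.1) hD
      have e4 : (fun v v' j => col G.1 (f G v) (q G v' j)) =
        fun v v' j => col G0.1 (f G0 v) (q G0 v' j) := congrArg (fun p => p.2.2.2.1) hD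
      have e5 : cgComap G.1 (g (f G)) = cgComap G0.1 (g (f G0)) :=
        congrArg (fun p => p.2.2.2.2.1) hD
      rw [e1] at e3 e4 e5
      rw [e2] at e4
      refine ⟨hobtf G, ?_, ?_, ?_⟩
      · intro u hu w hw
        have hr := hg (f G0) hco.1
        have hu' : u ∈ Set.range (g (f G0)) := by rw [hr]; exact hu
        have hw' : w ∈ Set.range (g (f G0)) := by rw [hr]; exact hw
        obtain ⟨u, rfl⟩ := hu'
        obtain ⟨w, rfl⟩ := hw'
        rw [← col_comap, ← col_comap, e5]
      · intro v v'
        exact congrFun (congrFun e3 v) v'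
      · rintro v v' w ⟨j, rfl⟩
        exact congrFun (congrFun (congrFun e4 v) v') j
  have hcard := Finset.card_le_mul_card_image_of_maps_to
    (f := D) (s := Finset.univ) (t := Finset.univ) (fun _ _ => Finset.mem_univ _) ⌊M⌋₊
    (fun d _ => hfib d)
  have hF : Fintype.card (obtfSet (n - 2 * t)) = Fnum (n - 2 * t) := by
    unfold Fnum
    rw [← Nat.card_coe_set_eq, Nat.card_eq_fintype_card]
  have hX : (X3set n t ε C K2c).ncard = (Finset.univ : Finset (X3set n t ε C K2c)).card := by
    rw [← Nat.card_coe_set_eq, Nat.card_eq_fintype_card, Finset.card_univ]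
  rw [hX]
  have hcR : ((Finset.univ : Finset (X3set n t ε C K2c)).card : ℝ) ≤ (⌊M⌋₊ : ℝ) *
      ((Finset.univ : Finset ((Fin t ⊕ Fin t → Fin n) × (Fin t ⊕ Fin t → Fin L → Fin n) ×
      (Fin t ⊕ Fin t → Fin t ⊕ Fin t → Option Bool) ×
      (Fin t ⊕ Fin t → Fin t ⊕ Fin t → Fin L → Option Bool) ×
        (obtfSet (n - 2 * t)))).card : ℝ) := by
    exact_mod_cast hcard
  refine hcR.trans ?_
  refine mul_le_mul (Nat.floor_le hM0) (le_of_eq ?_) (by positivity) hM0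
  rw [Finset.card_univ, Fintype.card_prod, Fintype.card_prod, Fintype.card_prod,
    Fintype.card_prod, hF]
  simp only [Fintype.card_fun, Fintype.card_sum, Fintype.card_fin, Fintype.card_option,
    Fintype.card_bool, ← two_mul, ← pow_mul]
  push_cast
  norm_num
  ring

theorem numeric (ε C δ : ℝ) (hε : 0 < ε) (hC : 0 < C) (hδ : 0 < δ) :
    ∃ N : ℕ, ∀ n : ℕ, N ≤ n → ∀ t : ℕ, t ≤ ⌈C * Real.logb 2 n⌉₊ →
      2 ≤ n ∧
      2 * Real.logb 2 n * (1 + (⌈Real.logb 2 n⌉₊ : ℝ)) + 8 * t * (1 + (⌈Real.logb 2 n⌉₊ : ℝ)) +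
        2 * (2 * (t : ℝ) + 6 * (⌈C * Real.logb 2 n⌉₊ : ℝ) + 4 * (n : ℝ) ^ ((1 : ℝ) - ε))
        < δ * n := by
  set A : ℝ := 6 + 40 * (C + 1) with hA
  have hA0 : 0 < A := by positivity
  have l1 : Tendsto (fun n : ℕ => Real.logb 2 n ^ 2 / (n : ℝ)) atTop (nhds 0) := by
    have h := (isLittleO_log_rpow_rpow_atTop (s := 1) 2 one_pos).tendsto_div_nhds_zero
    have h' := (h.const_mul (1 / Real.log 2 ^ 2)).comp tendsto_natCast_atTop_atTop
    rw [mul_zero] at h'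
    refine h'.congr ?_
    intro n
    simp only [Function.comp, Real.logb, Real.rpow_one, Real.rpow_two]
    ring
  have l2 : Tendsto (fun n : ℕ => (n : ℝ) ^ (-ε)) atTop (nhds 0) :=
    (tendsto_rpow_neg_atTop hε).comp tendsto_natCast_atTop_atTop
  have l3 : Tendsto (fun n : ℕ => A * (Real.logb 2 n ^ 2 / (n : ℝ)) + 8 * (n : ℝ) ^ (-ε))
      atTop (nhds 0) := by
    simpa using (l1.const_mul A).add (l2.const_mul 8)
  have ev := l3.eventually_lt_const hδ
  obtain ⟨N, hN⟩ := eventually_atTop.1 (ev.and (eventually_ge_atTop 2))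
  refine ⟨N, fun n hn t ht => ?_⟩
  obtain ⟨h1, h2⟩ := hN n hn
  refine ⟨h2, ?_⟩
  have hn2 : (2 : ℝ) ≤ n := by exact_mod_cast h2
  have hn0 : (0 : ℝ) < n := by linarith
  set ℓ := Real.logb 2 n with hℓ
  have hℓ1 : 1 ≤ ℓ := by
    rw [hℓ, Real.le_logb_iff_rpow_le (by norm_num) hn0]
    simpa using hn2
  have hL : (⌈ℓ⌉₊ : ℝ) < ℓ + 1 := Nat.ceil_lt_add_one (by linarith)
  have hs : (⌈C * ℓ⌉₊ : ℝ) < C * ℓ + 1 := Nat.ceil_lt_add_one (by positivity)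
  have htR : (t : ℝ) ≤ (⌈C * ℓ⌉₊ : ℝ) := by exact_mod_cast ht
  have hs' : (⌈C * ℓ⌉₊ : ℝ) ≤ (C + 1) * ℓ := by nlinarith
  have ht' : (t : ℝ) ≤ (C + 1) * ℓ := by linarith
  have hL' : 1 + (⌈ℓ⌉₊ : ℝ) ≤ 3 * ℓ := by linarith
  have hp : (n : ℝ) ^ ((1 : ℝ) - ε) = n * (n : ℝ) ^ (-ε) := by
    rw [sub_eq_add_neg, Real.rpow_add hn0, Real.rpow_one]
  have h1' : A * ℓ ^ 2 + 8 * (n : ℝ) ^ ((1 : ℝ) - ε) < δ * n := by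
    have := mul_lt_mul_of_pos_right h1 hn0
    rw [hp]
    calc _ = (A * (ℓ ^ 2 / n) + 8 * (n : ℝ) ^ (-ε)) * n := by field_simp
      _ < _ := this
  refine lt_of_le_of_lt ?_ h1'
  have m1 : 2 * ℓ * (1 + (⌈ℓ⌉₊ : ℝ)) ≤ 2 * ℓ * (3 * ℓ) := by gcongr
  have m2 : 8 * t * (1 + (⌈ℓ⌉₊ : ℝ)) ≤ 8 * ((C + 1) * ℓ) * (3 * ℓ) := by gcongr
  have m3 : (C + 1) * ℓ ≤ (C + 1) * ℓ ^ 2 := by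
    gcongr
    nlinarith
  rw [hA]
  nlinarith

theorem final_ineq (n t L : ℕ) (ℓ τ δ P F : ℝ) (hn : (n : ℝ) = 2 ^ ℓ) (ht : 1 ≤ t)
    (hτ : 0 ≤ τ) (hP : 0 < P) (hF : 0 < F)
    (h : 2 * ℓ * (1 + (L : ℝ)) + 8 * t * (1 + (L : ℝ)) + 2 * τ < δ * n) :
    (4 ^ n * P * 3 ^ τ) ^ t *
      ((n : ℝ) ^ (2 * t) * (n : ℝ) ^ (L * (2 * t)) * 3 ^ (2 * t * (2 * t)) *
        3 ^ (L * (2 * t) * (2 * t)) * F) <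
      P ^ t * (2 : ℝ) ^ (δ * n * t) * (4 : ℝ) ^ (n * t) * F := by
  have h4 : ∀ k : ℕ, (3 : ℝ) ^ k ≤ (2 : ℝ) ^ (2 * (k : ℝ)) := by
    intro k
    rw [Real.rpow_mul (by norm_num), Real.rpow_natCast]
    apply pow_le_pow_left₀ (by norm_num)
    norm_num
  have h5 : ((3 : ℝ) ^ τ) ^ t ≤ (2 : ℝ) ^ (2 * τ * t) := by
    rw [Real.rpow_mul (by norm_num), Real.rpow_natCast]
    apply pow_le_pow_left₀ (by positivity)
    rw [Real.rpow_mul (by norm_num)]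
    apply Real.rpow_le_rpow (by norm_num) (by norm_num) hτ
  have h6 : ∀ k : ℕ, (n : ℝ) ^ k = (2 : ℝ) ^ (ℓ * (k : ℝ)) := by
    intro k
    rw [hn, Real.rpow_mul (by norm_num), Real.rpow_natCast]
  have key : ((3 : ℝ) ^ τ) ^ t * ((n : ℝ) ^ (2 * t) * (n : ℝ) ^ (L * (2 * t)) *
      3 ^ (2 * t * (2 * t)) * 3 ^ (L * (2 * t) * (2 * t))) < (2 : ℝ) ^ (δ * n * t) := by
    calc _ ≤ (2 : ℝ) ^ (2 * τ * t) * ((2 : ℝ) ^ (ℓ * ((2 * t : ℕ) : ℝ)) *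
          (2 : ℝ) ^ (ℓ * ((L * (2 * t) : ℕ) : ℝ)) * (2 : ℝ) ^ (2 * ((2 * t * (2 * t) : ℕ) : ℝ)) *
          (2 : ℝ) ^ (2 * ((L * (2 * t) * (2 * t) : ℕ) : ℝ))) := by
          rw [h6, h6]
          gcongr
          · exact h4 _
          · exact h4 _
      _ = (2 : ℝ) ^ ((2 * ℓ * (1 + (L : ℝ)) + 8 * t * (1 + (L : ℝ)) + 2 * τ) * t) := by
          rw [← Real.rpow_add (by norm_num), ← Real.rpow_add (by norm_num),
            ← Real.rpow_add (by norm_num), ← Real.rpow_add (by norm_num)]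
          congr 1
          push_cast
          ring
      _ < _ := by
          apply Real.rpow_lt_rpow_of_exponent_lt (by norm_num)
          have : (0 : ℝ) < t := by exact_mod_cast ht
          exact mul_lt_mul_of_pos_right h this
  have hpos : 0 < P ^ t * (4 : ℝ) ^ (n * t) * F := by positivity
  calc _ = (P ^ t * (4 : ℝ) ^ (n * t) * F) * (((3 : ℝ) ^ τ) ^ t * ((n : ℝ) ^ (2 * t) *
      (n : ℝ) ^ (L * (2 * t)) * 3 ^ (2 * t * (2 * t)) * 3 ^ (L * (2 * t) * (2 * t)))) := by
        rw [mul_pow, mul_pow, ← pow_mul (4 : ℝ)]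
        ring
    _ < (P ^ t * (4 : ℝ) ^ (n * t) * F) * (2 : ℝ) ^ (δ * n * t) :=
        mul_lt_mul_of_pos_left key hpos
    _ = _ := by ring

/-- Lemma 3.6: there is an `ε₀ > 0` such that for all `ε ∈ (0,ε₀)`, `C > 0` and
`δ > 0`, for large `n`, any maximum choices `K2(G)`, and `1 ≤ t ≤ s = ⌈C log₂ n⌉`,
`|X3(n,t)| < (3/4)^{εnt} 2^{δnt} 4^{nt} F(n-2t)`. -/
theorem X3_count :
    ∃ ε₀ : ℝ, 0 < ε₀ ∧ ∀ ε : ℝ, 0 < ε → ε < ε₀ → ∀ C : ℝ, 0 < C → ∀ δ : ℝ, 0 < δ →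
      ∃ N : ℕ, ∀ n : ℕ, N ≤ n →
        ∀ K2c : ColoredGraph n → Set (Fin n), (∀ G, IsMaxK2 G ε (K2c G)) →
        ∀ t : ℕ, 1 ≤ t → t ≤ ⌈C * Real.logb 2 n⌉₊ →
          ((X3set n t ε C K2c).ncard : ℝ) <
            ((3 : ℝ) / 4) ^ (ε * n * t) * (2 : ℝ) ^ (δ * n * t) * (4 : ℝ) ^ (n * t) *
              Fnum (n - 2 * t) := by
  refine ⟨1, one_pos, fun ε hε _ C hC δ hδ => ?_⟩
  obtain ⟨N, hN⟩ := numeric ε C δ hε hC hδ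
  refine ⟨N, fun n hn K2c hK2 t ht hts => ?_⟩
  obtain ⟨h2, h⟩ := hN n hn t hts
  refine lt_of_le_of_lt (X3_count_raw ε C K2c hK2 ht) ?_
  have hn0 : (0 : ℝ) < n := by
    have : 0 < n := by omega
    exact_mod_cast this
  have e : ((3 : ℝ) / 4) ^ (ε * n * t) = (((3 : ℝ) / 4) ^ (ε * n)) ^ t := by
    rw [Real.rpow_mul (by norm_num), Real.rpow_natCast]
  rw [e]
  apply final_ineq n t _ (Real.logb 2 n) _ δ _ _ _ ht (by positivity) (by positivity) _ h
  · rw [Real.rpow_logb (by norm_num) (by norm_num) hn0]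
  · exact_mod_cast Fnum_pos _
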